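/- arXiv:0707.4470 — 4 statements merged into one kernel-verified Lean document; each statement's English description precedes it below -/
import Mathlib

section
/- Fix Δt, Δx, Δy, Δz > 0. Let Dx, Dy, Dz, Hx, Hy, Hz, Jx, Jy, Jz : ℤ × ℤ³ → ℝ and ρ : ℤ × ℤ³ → ℝ satisfy, for all (n;k,l,m), the Yee–Ampère update equations: (Dx(n;k,l,m)−Dx(n−1;k,l,m))/Δt = (Hz(n;k,l,m)−Hz(n;k,l−1,m))/Δy − (Hy(n;k,l,m)−Hy(n;k,l,m−1))/Δz − Jx(n;k,l,m); (Dy(n;k,l,m)−Dy(n−1;k,l,m))/Δt = (Hx(n;k,l,m)−Hx(n;k,l,m−1))/Δz − (Hz(n;k,l,m)−Hz(n;k−1,l,m))/Δx − Jy(n;k,l,m); (Dz(n;k,l,m)−Dz(n−1;k,l,m))/Δt = (Hy(n;k,l,m)−Hy(n;k−1,l,m))/Δx − (Hx(n;k,l,m)−Hx(n;k,l−1,m))/Δy − Jz(n;k,l,m); together with the discrete continuity equation (ρ(n;k,l,m)−ρ(n−1;k,l,m))/Δt + div⁻J(n;k,l,m) = 0. Then the discrete Gauss quantity is exactly conserved: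 for all n, k, l, m, div⁻D(n;k,l,m) − ρ(n;k,l,m) = div⁻D(n−1;k,l,m) − ρ(n−1;k,l,m). -/
/-- Discrete (backward) divergence of the grid field `(Fx, Fy, Fz)` at time index `n`
and spatial index `(k, l, m)`. -/
noncomputable def divb (Δx Δy Δz : ℝ) (Fx Fy Fz : ℤ → ℤ → ℤ → ℤ → ℝ)
    (n k l m : ℤ) : ℝ :=
  (Fx n k l m - Fx n (k - 1) l m) / Δx +
  (Fy n k l m - Fy n k (l - 1) m) / Δy +
  (Fz n k l m - Fz n k l (m - 1)) / Δz

/-- The Yee–Ampère update equations, together with the discrete continuity equation,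
exactly conserve the discrete Gauss quantity `div⁻D − ρ`. -/
theorem yee_gauss_conserved
    (Δt Δx Δy Δz : ℝ) (hΔt : 0 < Δt) (hΔx : 0 < Δx) (hΔy : 0 < Δy) (hΔz : 0 < Δz)
    (Dx Dy Dz Hx Hy Hz Jx Jy Jz ρ : ℤ → ℤ → ℤ → ℤ → ℝ)
    (ampereX : ∀ n k l m : ℤ,
      (Dx n k l m - Dx (n - 1) k l m) / Δt =
        (Hz n k l m - Hz n k (l - 1) m) / Δy - (Hy n k l m - Hy n k l (m - 1)) / Δz
          - Jx n k l m)
    (ampereY : ∀ n k l m : ℤ,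
      (Dy n k l m - Dy (n - 1) k l m) / Δt =
        (Hx n k l m - Hx n k l (m - 1)) / Δz - (Hz n k l m - Hz n (k - 1) l m) / Δx
          - Jy n k l m)
    (ampereZ : ∀ n k l m : ℤ,
      (Dz n k l m - Dz (n - 1) k l m) / Δt =
        (Hy n k l m - Hy n (k - 1) l m) / Δx - (Hx n k l m - Hx n k (l - 1) m) / Δy
          - Jz n k l m)
    (continuity : ∀ n k l m : ℤ,
      (ρ n k l m - ρ (n - 1) k l m) / Δt + divb Δx Δy Δz Jx Jy Jz n k l m = 0) :
    ∀ n k l m : ℤ,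
      divb Δx Δy Δz Dx Dy Dz n k l m - ρ n k l m =
        divb Δx Δy Δz Dx Dy Dz (n - 1) k l m - ρ (n - 1) k l m := by
  intro n k l m
  have hrate : ((divb Δx Δy Δz Dx Dy Dz n k l m - ρ n k l m) -
      (divb Δx Δy Δz Dx Dy Dz (n - 1) k l m - ρ (n - 1) k l m)) / Δt = 0 := by
    have hρ := continuity n k l m
    unfold divb at hρ ⊢
    linear_combination (ampereX n k l m - ampereX n (k - 1) l m) / Δx +
      (ampereY n k l m - ampereY n k (l - 1) m) / Δy +
      (ampereZ n k l m - ampereZ n k l (m - 1)) / Δz - hρ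
  exact sub_eq_zero.mp ((div_eq_zero_iff.mp hrate).resolve_right hΔt.ne')
end

section
/- Let V, Ed, F be finite types, let d₀ be an Ed × V real matrix and d₁ an F × Ed real matrix with d₁ · d₀ = 0. Let (Δtₙ)ₙ be any sequence of real numbers, and let D, J : ℕ → (Ed → ℝ), H : ℕ → (F → ℝ), and ρ : ℕ → (V → ℝ) satisfy, for all n, the generalized discrete Ampère update D(n+1) = D(n) + Δtₙ · (d₁ᵀ · H(n) − J(n)) and the discrete continuity equation ρ(n+1) = ρ(n) − Δtₙ · (d₀ᵀ · J(n)). Then the discrete Gauss quantity is exactly conserved: d₀ᵀ · D(n) − ρ(n) = d₀ᵀ · D(0) − ρ(0) for all n. -/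
open Matrix

/-- On an unstructured mesh encoded by incidence matrices `d₀` (vertices-to-edges) and
`d₁` (edges-to-faces) with `d₁ * d₀ = 0`, the generalized discrete Ampère update
`D(n+1) = D(n) + Δtₙ · (d₁ᵀ · H(n) − J(n))` together with the discrete continuity
equation `ρ(n+1) = ρ(n) − Δtₙ · (d₀ᵀ · J(n))` exactly conserves the discrete Gauss
quantity `d₀ᵀ · D(n) − ρ(n)`. -/
theorem generalized_ampere_gauss_conserved
    {V Ed F : Type*} [Fintype V] [Fintype Ed] [Fintype F]
    (d₀ : Matrix Ed V ℝ) (d₁ : Matrix F Ed ℝ) (hd : d₁ * d₀ = 0)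
    (Δt : ℕ → ℝ)
    (D J : ℕ → Ed → ℝ) (H : ℕ → F → ℝ) (ρ : ℕ → V → ℝ)
    (ampere : ∀ n : ℕ, D (n + 1) = D n + Δt n • (d₁.transpose.mulVec (H n) - J n))
    (continuity : ∀ n : ℕ, ρ (n + 1) = ρ n - Δt n • d₀.transpose.mulVec (J n)) :
    ∀ n : ℕ, d₀.transpose.mulVec (D n) - ρ n = d₀.transpose.mulVec (D 0) - ρ 0 := by
  intro n
  induction n with
  | zero => rfl
  | succ k ih =>
    have dual_sq_zero : d₀.transpose.mulVec (d₁.transpose.mulVec (H k)) = 0 := by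
      rw [mulVec_mulVec, ← transpose_mul, hd, transpose_zero, zero_mulVec]
    rw [← ih, ampere, continuity, mulVec_add, mulVec_smul, mulVec_sub, dual_sq_zero, zero_sub,
      smul_neg]
    abel
end

section
/- Let Ed and F be finite types, d₁ an F × Ed real matrix, Mₑ a symmetric Ed × Ed real matrix, M_b a symmetric F × F real matrix, Δt > 0, and J : ℤ → (Ed → ℝ) finitely supported. For finitely supported A : ℤ → (Ed → ℝ) (i.e., A(n) = 0 for all but finitely many n), define E_A(n) := −(A(n+1) − A(n))/Δt and B_A(n) := d₁ · A(n), and define the discrete action S(A) := Σₙ Δt · ( ½ E_A(n)ᵀ Mₑ E_A(n) − ½ B_A(n)ᵀ M_b B_A(n) + A(n)ᵀ J(n) ) (a finite sum). Then A is a critical point of S — meaning that for every finitely supported variation α : ℤ → (Ed → ℝ), the derivative (d/dε) S(A + ε·α) at ε = 0 vanishes — if and only if A satisfies the discrete Maxwell (Ampère) evolution equation Mₑ · (E_A(n) − E_A(n−1))/Δt = d₁ᵀ · (M_b · B_A(n)) − J(n) for all n ∈ ℤ. In particular, the Yee and Bossavit–Kettunen schemes are variational integrators. -/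
open Matrix

section DiscreteMaxwellAction

variable {Ed F : Type*} [Fintype Ed] [Fintype F]

/-- The discrete electric field associated to a discrete vector potential `A`:
`E_A(n) = −(A(n+1) − A(n))/Δt`. -/
noncomputable def discE (Δt : ℝ) (A : ℤ → Ed → ℝ) (n : ℤ) : Ed → ℝ :=
  -(Δt⁻¹ • (A (n + 1) - A n))

/-- The discrete magnetic flux associated to a discrete vector potential `A`:
`B_A(n) = d₁ · A(n)`. -/
noncomputable def discB (d₁ : Matrix F Ed ℝ) (A : ℤ → Ed → ℝ) (n : ℤ) : F → ℝ :=
  d₁.mulVec (A n)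

/-- The discrete electromagnetic action
`S(A) = Σₙ Δt · (½ E_A(n)ᵀ Mₑ E_A(n) − ½ B_A(n)ᵀ M_b B_A(n) + A(n)ᵀ J(n))`. -/
noncomputable def discAction (d₁ : Matrix F Ed ℝ) (Me : Matrix Ed Ed ℝ)
    (Mb : Matrix F F ℝ) (Δt : ℝ) (J : ℤ → Ed → ℝ) (A : ℤ → Ed → ℝ) : ℝ :=
  ∑ᶠ n : ℤ, Δt *
    ((1 / 2) * (discE Δt A n ⬝ᵥ Me.mulVec (discE Δt A n))
      - (1 / 2) * (discB d₁ A n ⬝ᵥ Mb.mulVec (discB d₁ A n))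
      + (A n ⬝ᵥ J n))

theorem discE_add_smul (Δt ε : ℝ) (A α : ℤ → Ed → ℝ) (n : ℤ) :
    discE Δt (fun k => A k + ε • α k) n = discE Δt A n + ε • discE Δt α n := by
  ext e
  simp only [discE, Pi.neg_apply, Pi.smul_apply, Pi.sub_apply, Pi.add_apply, smul_eq_mul]
  ring

theorem discB_add_smul (d₁ : Matrix F Ed ℝ) (ε : ℝ) (A α : ℤ → Ed → ℝ) (n : ℤ) :
    discB d₁ (fun k => A k + ε • α k) n = discB d₁ A n + ε • discB d₁ α n := by
  simp only [discB, mulVec_add, mulVec_smul]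

/-- The directional derivative of the quadratic form of a symmetric matrix. -/
theorem hasDerivAt_dotProduct_mulVec_add_smul {M : Matrix Ed Ed ℝ} (hM : M.IsSymm)
    (x y : Ed → ℝ) :
    HasDerivAt (fun ε : ℝ => (x + ε • y) ⬝ᵥ M.mulVec (x + ε • y)) (2 * (y ⬝ᵥ M.mulVec x)) 0 := by
  have hsymm : x ⬝ᵥ M.mulVec y = y ⬝ᵥ M.mulVec x := by
    rw [dotProduct_mulVec, ← mulVec_transpose, hM.eq, dotProduct_comm]
  have hexpand : (fun ε : ℝ => (x + ε • y) ⬝ᵥ M.mulVec (x + ε • y)) =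
      fun ε => x ⬝ᵥ M.mulVec x + ε * (2 * (y ⬝ᵥ M.mulVec x)) + ε ^ 2 * (y ⬝ᵥ M.mulVec y) := by
    ext ε
    simp only [mulVec_add, mulVec_smul, dotProduct_add, add_dotProduct, dotProduct_smul,
      smul_dotProduct, smul_eq_mul, hsymm]
    ring
  rw [hexpand]
  have h := (((hasDerivAt_id (0 : ℝ)).mul_const (2 * (y ⬝ᵥ M.mulVec x))).const_add
    (x ⬝ᵥ M.mulVec x)).add (((hasDerivAt_id (0 : ℝ)).pow 2).mul_const (y ⬝ᵥ M.mulVec y))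
  refine h.congr_deriv ?_
  simp

/-- The first variation of the discrete action at `A` in the direction `α`. -/
theorem hasDerivAt_discAction (d₁ : Matrix F Ed ℝ) {Me : Matrix Ed Ed ℝ} {Mb : Matrix F F ℝ}
    (hMe : Me.IsSymm) (hMb : Mb.IsSymm) (Δt : ℝ) (J : ℤ → Ed → ℝ) {A α : ℤ → Ed → ℝ}
    (hA : (Function.support A).Finite) (hα : (Function.support α).Finite) :
    HasDerivAt (fun ε : ℝ => discAction d₁ Me Mb Δt J (fun n => A n + ε • α n))
      (∑ᶠ n : ℤ, Δt * (discE Δt α n ⬝ᵥ Me.mulVec (discE Δt A n)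
        - discB d₁ α n ⬝ᵥ Mb.mulVec (discB d₁ A n) + α n ⬝ᵥ J n)) 0 := by
  have hfin := hA.union hα
  have hshift := hfin.preimage (add_left_injective (1 : ℤ)).injOn
  set s := (hfin.union hshift).toFinset with hs
  have hzero : ∀ n, n ∉ s → A n = 0 ∧ α n = 0 ∧ A (n + 1) = 0 ∧ α (n + 1) = 0 := by
    intro n hn
    simp only [hs, Set.Finite.mem_toFinset, Set.mem_union, Set.mem_preimage,
      Function.mem_support] at hn
    tauto
  have hsum : (fun ε : ℝ => discAction d₁ Me Mb Δt J (fun n => A n + ε • α n)) = fun ε =>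
      ∑ n ∈ s, Δt *
        ((1 / 2) * ((discE Δt A n + ε • discE Δt α n) ⬝ᵥ
            Me.mulVec (discE Δt A n + ε • discE Δt α n))
          - (1 / 2) * ((discB d₁ A n + ε • discB d₁ α n) ⬝ᵥ
            Mb.mulVec (discB d₁ A n + ε • discB d₁ α n))
          + (A n + ε • α n) ⬝ᵥ J n) := by
    ext ε
    simp only [discAction, discE_add_smul, discB_add_smul]
    refine finsum_eq_sum_of_support_subset _ (Function.support_subset_iff'.2 fun n hn => ?_)
    obtain ⟨h₁, h₂, h₃, h₄⟩ := hzero n hn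
    simp [discE, discB, h₁, h₂, h₃, h₄]
  rw [hsum, finsum_eq_sum_of_support_subset (s := s) _
    (Function.support_subset_iff'.2 fun n hn => by
      obtain ⟨h₁, h₂, h₃, h₄⟩ := hzero n hn
      simp [discE, discB, h₁, h₂, h₃, h₄])]
  refine HasDerivAt.fun_sum fun n _ => ?_
  have hJn : HasDerivAt (fun ε : ℝ => (A n + ε • α n) ⬝ᵥ J n) (α n ⬝ᵥ J n) 0 := by
    simp only [add_dotProduct, smul_dotProduct, smul_eq_mul]
    simpa using ((hasDerivAt_id (0 : ℝ)).mul_const (α n ⬝ᵥ J n)).const_add (A n ⬝ᵥ J n)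
  have hE := hasDerivAt_dotProduct_mulVec_add_smul hMe (discE Δt A n) (discE Δt α n)
  have hB := hasDerivAt_dotProduct_mulVec_add_smul hMb (discB d₁ A n) (discB d₁ α n)
  refine ((((hE.const_mul (1 / 2)).sub (hB.const_mul (1 / 2))).add hJn).const_mul Δt).congr_deriv ?_
  ring

/-- Discrete integration by parts: the first variation of the action is the pairing of the
variation with the residual of the discrete Ampère equation. -/
theorem finsum_first_variation_eq (d₁ : Matrix F Ed ℝ) (Me : Matrix Ed Ed ℝ)
    (Mb : Matrix F F ℝ) {Δt : ℝ} (hΔt : Δt ≠ 0) (J A : ℤ → Ed → ℝ) {α : ℤ → Ed → ℝ}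
    (hα : (Function.support α).Finite) :
    ∑ᶠ n : ℤ, Δt * (discE Δt α n ⬝ᵥ Me.mulVec (discE Δt A n)
        - discB d₁ α n ⬝ᵥ Mb.mulVec (discB d₁ A n) + α n ⬝ᵥ J n) =
      ∑ᶠ n : ℤ, Δt * (α n ⬝ᵥ (Δt⁻¹ • Me.mulVec (discE Δt A n - discE Δt A (n - 1))
        - (d₁.transpose.mulVec (Mb.mulVec (discB d₁ A n)) - J n))) := by
  set g : ℤ → ℝ := fun n => α n ⬝ᵥ Me.mulVec (discE Δt A (n - 1)) with hg
  have hgfin : (Function.support g).Finite :=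
    hα.subset fun n hn h => hn (by simp [hg, h])
  have hgshift : (Function.support fun n => g (n + 1)).Finite :=
    hgfin.preimage (add_left_injective (1 : ℤ)).injOn
  have hterm : ∀ n : ℤ, Δt * (discE Δt α n ⬝ᵥ Me.mulVec (discE Δt A n)
        - discB d₁ α n ⬝ᵥ Mb.mulVec (discB d₁ A n) + α n ⬝ᵥ J n) =
      Δt * (α n ⬝ᵥ (Δt⁻¹ • Me.mulVec (discE Δt A n - discE Δt A (n - 1))
        - (d₁.transpose.mulVec (Mb.mulVec (discB d₁ A n)) - J n))) + (g n - g (n + 1)) := by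
    intro n
    have hE : discE Δt α n = -(Δt⁻¹ • (α (n + 1) - α n)) := rfl
    have hB : discB d₁ α n ⬝ᵥ Mb.mulVec (discB d₁ A n) =
        α n ⬝ᵥ d₁.transpose.mulVec (Mb.mulVec (discB d₁ A n)) := by
      rw [dotProduct_mulVec (α n), vecMul_transpose, discB]
    rw [hB, hE]
    simp only [hg, add_sub_cancel_right, mulVec_sub, dotProduct_sub, dotProduct_smul,
      neg_dotProduct, smul_dotProduct, sub_dotProduct, smul_eq_mul]
    field_simp
    ring
  have htelescope : ∑ᶠ n : ℤ, (g n - g (n + 1)) = 0 := by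
    rw [finsum_sub_distrib hgfin hgshift, sub_eq_zero]
    exact (finsum_comp_equiv (Equiv.addRight (1 : ℤ)) (f := g)).symm
  rw [finsum_congr hterm, finsum_add_distrib, htelescope, add_zero]
  · exact hα.subset fun n hn h => hn (by simp [h])
  · exact (hgfin.union hgshift).subset (Function.support_sub _ _)

/-- A finitely supported discrete vector potential `A` is a critical point of the
discrete electromagnetic action (with respect to all finitely supported variations)
if and only if it satisfies the discrete Maxwell (Ampère) evolution equation
`Mₑ · (E_A(n) − E_A(n−1))/Δt = d₁ᵀ · (M_b · B_A(n)) − J(n)` for all `n`.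
In particular, the Yee and Bossavit–Kettunen schemes are variational integrators. -/
theorem discrete_maxwell_variational
    (d₁ : Matrix F Ed ℝ) (Me : Matrix Ed Ed ℝ) (Mb : Matrix F F ℝ)
    (hMe : Me.IsSymm) (hMb : Mb.IsSymm)
    (Δt : ℝ) (hΔt : 0 < Δt)
    (J : ℤ → Ed → ℝ) (hJ : (Function.support J).Finite)
    (A : ℤ → Ed → ℝ) (hA : (Function.support A).Finite) :
    (∀ α : ℤ → Ed → ℝ, (Function.support α).Finite →
        deriv (fun ε : ℝ =>
          discAction d₁ Me Mb Δt J (fun n => A n + ε • α n)) 0 = 0)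
      ↔ (∀ n : ℤ,
          Δt⁻¹ • Me.mulVec (discE Δt A n - discE Δt A (n - 1)) =
            d₁.transpose.mulVec (Mb.mulVec (discB d₁ A n)) - J n) := by
  have hderiv : ∀ α : ℤ → Ed → ℝ, (Function.support α).Finite →
      deriv (fun ε : ℝ => discAction d₁ Me Mb Δt J (fun n => A n + ε • α n)) 0 =
        ∑ᶠ n : ℤ, Δt * (α n ⬝ᵥ (Δt⁻¹ • Me.mulVec (discE Δt A n - discE Δt A (n - 1))
          - (d₁.transpose.mulVec (Mb.mulVec (discB d₁ A n)) - J n))) := fun α hα =>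
    (hasDerivAt_discAction d₁ hMe hMb Δt J hA hα).deriv.trans
      (finsum_first_variation_eq d₁ Me Mb hΔt.ne' J A hα)
  constructor
  · intro h n
    set r := Δt⁻¹ • Me.mulVec (discE Δt A n - discE Δt A (n - 1))
      - (d₁.transpose.mulVec (Mb.mulVec (discB d₁ A n)) - J n) with hr
    have hfin : (Function.support (Pi.single n r : ℤ → Ed → ℝ)).Finite :=
      (Set.finite_singleton n).subset Pi.support_single_subset
    have hcrit := h _ hfin
    rw [hderiv _ hfin, finsum_eq_single _ n fun m hm => by simp [Pi.single_eq_of_ne hm],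
      Pi.single_eq_same, ← hr] at hcrit
    exact sub_eq_zero.1
      (dotProduct_self_eq_zero.1 ((mul_eq_zero.1 hcrit).resolve_left hΔt.ne'))
  · intro h α hα
    rw [hderiv α hα]
    simp [h]

end DiscreteMaxwellAction
end

section
/- Let n = k + m with k, m ≥ 1, and identify ℝⁿ = ℝᵏ × ℝᵐ. Let K ⊆ ℝᵏ and L ⊆ ℝᵐ be compact convex sets with 0 ∈ K and 0 ∈ L. Then the n-dimensional Lebesgue volume of the convex hull of (K × {0}) ∪ ({0} × L) equals (k! · m! / n!) · volₖ(K) · volₘ(L), where volₖ and volₘ denote Lebesgue measure on ℝᵏ and ℝᵐ respectively. Equivalently, vol(conv((K×{0}) ∪ ({0}×L))) = binom(n,k)⁻¹ · volₖ(K) · volₘ(L). -/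
open MeasureTheory
open scoped ENNReal

open Set
open scoped Pointwise Nat

/-- The Beta integral at natural-number exponents. -/
theorem integral_pow_mul_one_sub_pow (k j : ℕ) :
    ∫ t in (0 : ℝ)..1, t ^ k * (1 - t) ^ j = (k ! * j ! : ℝ) / (k + j + 1)! := by
  induction k generalizing j with
  | zero =>
    have h := intervalIntegral.integral_comp_sub_left (fun t : ℝ => t ^ j) (a := 0) (b := 1) 1
    simp only [pow_zero, one_mul, h]
    simp only [sub_self, sub_zero, integral_pow, zero_add, Nat.factorial_succ, Nat.factorial_zero]
    have := Nat.factorial_ne_zero j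
    push_cast
    field_simp
    simp
  | succ k ih =>
    have hu (t : ℝ) : HasDerivAt (fun t : ℝ => t ^ (k + 1)) ((k + 1) * t ^ k) t := by
      simpa using hasDerivAt_pow (k + 1) t
    have hv (t : ℝ) :
        HasDerivAt (fun t : ℝ => -(1 - t) ^ (j + 1) / (j + 1)) ((1 - t) ^ j) t := by
      have := ((((hasDerivAt_id t).const_sub 1).pow (j + 1)).neg).div_const ((j : ℝ) + 1)
      refine this.congr_deriv ?_
      have : (j : ℝ) + 1 ≠ 0 := by positivity
      push_cast
      field_simp
      simp
    rw [intervalIntegral.integral_mul_deriv_eq_deriv_mul (fun t _ => hu t) (fun t _ => hv t)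
      (Continuous.intervalIntegrable (by fun_prop) _ _)
      (Continuous.intervalIntegrable (by fun_prop) _ _)]
    have h (t : ℝ) : (k + 1) * t ^ k * (-(1 - t) ^ (j + 1) / (j + 1))
        = -((k + 1) / (j + 1)) * (t ^ k * (1 - t) ^ (j + 1)) := by ring
    simp only [h, intervalIntegral.integral_const_mul, ih]
    rw [show k + 1 + j + 1 = k + (j + 1) + 1 by ring, Nat.factorial_succ k, Nat.factorial_succ j]
    have : (j : ℝ) + 1 ≠ 0 := by positivity
    push_cast
    field_simp
    simp

theorem StarConvex.smul_subset_smul {E : Type*} [AddCommGroup E] [Module ℝ E] {K : Set E}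
    (hK : StarConvex ℝ 0 K) {s t : ℝ} (hs : 0 ≤ s) (hst : s ≤ t) : s • K ⊆ t • K := by
  rintro _ ⟨z, hz, rfl⟩
  rcases hs.eq_or_lt with rfl | hs
  · exact ⟨0, hK.mem ⟨z, hz⟩, by simp⟩
  · have ht : 0 < t := hs.trans_le hst
    refine ⟨(s / t) • z, hK.smul_mem hz (by positivity) ((div_le_one ht).2 hst), ?_⟩
    simp [smul_smul, mul_div_cancel₀ _ ht.ne']

/-- The set of dilation factors in `[0, 1]` for which the dilate of a compact star-shaped set
contains a given point of the set is an interval `[a, 1]`. -/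
theorem IsCompact.exists_forall_mem_smul_iff_le {E : Type*} [AddCommGroup E] [Module ℝ E]
    [TopologicalSpace E] [T2Space E] [ContinuousSMul ℝ E] {K : Set E}
    (hKc : IsCompact K) (hK : StarConvex ℝ 0 K) {x : E} (hx : x ∈ K) :
    ∃ a ∈ Icc (0 : ℝ) 1, ∀ t ∈ Icc (0 : ℝ) 1, x ∈ t • K ↔ a ≤ t := by
  have hc : IsCompact (Prod.fst '' ((Icc (0 : ℝ) 1 ×ˢ K) ∩ {p : ℝ × E | p.1 • p.2 = x})) :=
    ((isCompact_Icc.prod hKc).inter_right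
      (isClosed_eq (by fun_prop) continuous_const)).image continuous_fst
  obtain ⟨a, ⟨⟨a, z⟩, ⟨⟨ha, hz⟩, haz⟩, rfl⟩, hmin⟩ :=
    hc.exists_isLeast ⟨1, (1, x), ⟨⟨by simp, hx⟩, by simp⟩, rfl⟩
  refine ⟨a, ha, fun t ht => ⟨?_, fun h => hK.smul_subset_smul ha.1 h ⟨z, hz, haz⟩⟩⟩
  rintro ⟨y, hy, hyx⟩
  exact hmin ⟨(t, y), ⟨⟨ht, hy⟩, hyx⟩, rfl⟩

theorem mem_convexHull_union_prod_zero_iff {E F : Type*} [AddCommGroup E] [Module ℝ E]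
    [AddCommGroup F] [Module ℝ F] {K : Set E} {L : Set F}
    (hK : Convex ℝ K) (hL : Convex ℝ L) (hK0 : K.Nonempty) (hL0 : L.Nonempty) {x : E} {y : F} :
    (x, y) ∈ convexHull ℝ (((fun x : E => (x, (0 : F))) '' K) ∪ ((fun y : F => ((0 : E), y)) '' L))
      ↔ ∃ t ∈ Icc (0 : ℝ) 1, x ∈ t • K ∧ y ∈ (1 - t) • L := by
  have hKi : Convex ℝ ((fun x : E => (x, (0 : F))) '' K) := hK.linear_image (LinearMap.inl ℝ E F)
  have hLi : Convex ℝ ((fun y : F => ((0 : E), y)) '' L) := hL.linear_image (LinearMap.inr ℝ E F)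
  rw [hKi.convexHull_union hLi (hK0.image _) (hL0.image _), mem_convexJoin]
  constructor
  · rintro ⟨_, ⟨u, hu, rfl⟩, _, ⟨v, hv, rfl⟩, a, b, ha, hb, hab, h⟩
    simp only [Prod.smul_mk, smul_zero, Prod.mk_add_mk, add_zero, zero_add, Prod.mk.injEq] at h
    obtain rfl : b = 1 - a := by linarith
    exact ⟨a, ⟨ha, by linarith⟩, ⟨u, hu, h.1⟩, ⟨v, hv, h.2⟩⟩
  · rintro ⟨t, ht, ⟨u, hu, rfl⟩, ⟨v, hv, rfl⟩⟩
    exact ⟨_, ⟨u, hu, rfl⟩, _, ⟨v, hv, rfl⟩, t, 1 - t, ht.1, by linarith [ht.2], by ring, by simp⟩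

theorem isCompact_convexHull_union_prod_zero {E F : Type*} [AddCommGroup E] [Module ℝ E]
    [TopologicalSpace E] [ContinuousSMul ℝ E] [AddCommGroup F] [Module ℝ F]
    [TopologicalSpace F] [ContinuousSMul ℝ F] {K : Set E} {L : Set F}
    (hKc : IsCompact K) (hLc : IsCompact L)
    (hK : Convex ℝ K) (hL : Convex ℝ L) (hK0 : K.Nonempty) (hL0 : L.Nonempty) :
    IsCompact (convexHull ℝ
      (((fun x : E => (x, (0 : F))) '' K) ∪ ((fun y : F => ((0 : E), y)) '' L))) := by
  have hc := ((isCompact_Icc (a := (0 : ℝ)) (b := 1)).prod (hKc.prod hLc)).image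
    (f := fun p : ℝ × E × F => (p.1 • p.2.1, (1 - p.1) • p.2.2)) (by fun_prop)
  convert hc using 1
  ext ⟨x, y⟩
  rw [mem_convexHull_union_prod_zero_iff hK hL hK0 hL0]
  constructor
  · rintro ⟨t, ht, ⟨u, hu, rfl⟩, ⟨v, hv, rfl⟩⟩
    exact ⟨(t, u, v), ⟨ht, hu, hv⟩, rfl⟩
  · rintro ⟨⟨t, u, v⟩, ⟨ht, hu, hv⟩, h⟩
    obtain ⟨rfl, rfl⟩ := Prod.mk.inj h
    exact ⟨t, ht, ⟨u, hu, rfl⟩, ⟨v, hv, rfl⟩⟩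

theorem lintegral_Icc_succ_mul_one_sub_pow (j : ℕ) {a : ℝ} (ha : a ≤ 1) :
    ∫⁻ t in Icc a 1, ENNReal.ofReal ((j + 1) * (1 - t) ^ j)
      = ENNReal.ofReal ((1 - a) ^ (j + 1)) := by
  rw [← ofReal_integral_eq_lintegral_ofReal]
  · rw [integral_Icc_eq_integral_Ioc, ← intervalIntegral.integral_of_le ha,
      intervalIntegral.integral_const_mul,
      intervalIntegral.integral_comp_sub_left (fun t : ℝ => t ^ j) 1]
    congr 1
    have : (j : ℝ) + 1 ≠ 0 := by positivity
    simp only [sub_self, integral_pow]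
    field_simp
    simp
  · exact Continuous.integrableOn_Icc (by fun_prop)
  · filter_upwards [ae_restrict_mem measurableSet_Icc] with t ht
    have : 0 ≤ 1 - t := sub_nonneg.2 ht.2
    simp only [Pi.zero_apply]
    positivity

/-- The volume of the slice over `x` of the convex hull, as an integral over the dilation
factors `t` with `x ∈ t • K`. -/
theorem volume_slice_convexHull_union_prod_zero {k j : ℕ}
    {K : Set (Fin k → ℝ)} {L : Set (Fin (j + 1) → ℝ)}
    (hKc : IsCompact K) (hKconv : Convex ℝ K) (hK0 : 0 ∈ K)
    (hLconv : Convex ℝ L) (hL0 : 0 ∈ L) (x : Fin k → ℝ) :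
    volume (Prod.mk x ⁻¹' convexHull ℝ
        (((fun x : Fin k → ℝ => (x, (0 : Fin (j + 1) → ℝ))) '' K) ∪
          ((fun y : Fin (j + 1) → ℝ => ((0 : Fin k → ℝ), y)) '' L))) =
      (∫⁻ t, {t : ℝ | t ∈ Icc 0 1 ∧ x ∈ t • K}.indicator
        (fun t => ENNReal.ofReal ((j + 1) * (1 - t) ^ j)) t) * volume L := by
  have hKs := hKconv.starConvex hK0
  have hLs := hLconv.starConvex hL0
  by_cases hx : x ∈ K
  · obtain ⟨a, ha, hat⟩ := hKc.exists_forall_mem_smul_iff_le hKs hx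
    have hset : {t : ℝ | t ∈ Icc 0 1 ∧ x ∈ t • K} = Icc a 1 := by
      ext t
      exact ⟨fun h => ⟨(hat t h.1).1 h.2, h.1.2⟩,
        fun h => ⟨⟨ha.1.trans h.1, h.2⟩, (hat t ⟨ha.1.trans h.1, h.2⟩).2 h.1⟩⟩
    have hslice : Prod.mk x ⁻¹' convexHull ℝ
        (((fun x : Fin k → ℝ => (x, (0 : Fin (j + 1) → ℝ))) '' K) ∪
          ((fun y : Fin (j + 1) → ℝ => ((0 : Fin k → ℝ), y)) '' L)) = (1 - a) • L := by
      ext y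
      rw [mem_preimage, mem_convexHull_union_prod_zero_iff hKconv hLconv ⟨0, hK0⟩ ⟨0, hL0⟩]
      constructor
      · rintro ⟨t, ht, hxt, hyt⟩
        exact hLs.smul_subset_smul (sub_nonneg.2 ht.2)
          (sub_le_sub_left ((hat t ht).1 hxt) 1) hyt
      · exact fun hy => ⟨a, ha, (hat a ha).2 le_rfl, hy⟩
    rw [hslice, hset, lintegral_indicator measurableSet_Icc,
      lintegral_Icc_succ_mul_one_sub_pow j ha.2,
      Measure.addHaar_smul_of_nonneg volume (sub_nonneg.2 ha.2)]
    simp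
  · have hxt (t : ℝ) (ht : t ∈ Icc (0 : ℝ) 1) : x ∉ t • K := fun h =>
      hx (by simpa using hKs.smul_subset_smul ht.1 ht.2 h)
    have hset : {t : ℝ | t ∈ Icc 0 1 ∧ x ∈ t • K} = ∅ :=
      eq_empty_of_forall_notMem fun t h => hxt t h.1 h.2
    have hslice : Prod.mk x ⁻¹' convexHull ℝ
        (((fun x : Fin k → ℝ => (x, (0 : Fin (j + 1) → ℝ))) '' K) ∪
          ((fun y : Fin (j + 1) → ℝ => ((0 : Fin k → ℝ), y)) '' L)) = ∅ := by
      refine eq_empty_of_forall_notMem fun y hy => ?_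
      rw [mem_preimage, mem_convexHull_union_prod_zero_iff hKconv hLconv ⟨0, hK0⟩ ⟨0, hL0⟩] at hy
      obtain ⟨t, ht, h, -⟩ := hy
      exact hxt t ht h
    rw [hslice, hset]
    simp

theorem lintegral_lintegral_indicator_smul {k : ℕ} (j : ℕ) {K : Set (Fin k → ℝ)}
    (hKc : IsCompact K) :
    ∫⁻ x, ∫⁻ t, {t : ℝ | t ∈ Icc 0 1 ∧ x ∈ t • K}.indicator
        (fun t => ENNReal.ofReal ((j + 1) * (1 - t) ^ j)) t =
      ((k ! * (j + 1)! : ℝ≥0∞) / ((k + (j + 1))! : ℝ≥0∞)) * volume K := by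
  have hS : IsCompact {p : (Fin k → ℝ) × ℝ | p.2 ∈ Icc 0 1 ∧ p.1 ∈ p.2 • K} := by
    convert ((isCompact_Icc (a := (0 : ℝ)) (b := 1)).prod hKc).image
      (f := fun p : ℝ × (Fin k → ℝ) => (p.1 • p.2, p.1)) (by fun_prop) using 1
    ext ⟨x, t⟩
    constructor
    · rintro ⟨ht, z, hz, h⟩
      exact ⟨(t, z), ⟨ht, hz⟩, Prod.ext h rfl⟩
    · rintro ⟨⟨t, z⟩, ⟨ht, hz⟩, h⟩
      obtain ⟨rfl, rfl⟩ := Prod.mk.inj h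
      exact ⟨ht, z, hz, rfl⟩
  have hmeas : Measurable ({p : (Fin k → ℝ) × ℝ | p.2 ∈ Icc 0 1 ∧ p.1 ∈ p.2 • K}.indicator
      (fun p => ENNReal.ofReal ((j + 1) * (1 - p.2) ^ j))) :=
    Measurable.indicator (by fun_prop) hS.measurableSet
  rw [lintegral_lintegral_swap (f := fun x t => {t : ℝ | t ∈ Icc 0 1 ∧ x ∈ t • K}.indicator
        (fun t => ENNReal.ofReal ((j + 1) * (1 - t) ^ j)) t) hmeas.aemeasurable]
  have hinner (t : ℝ) : ∫⁻ x, {t : ℝ | t ∈ Icc 0 1 ∧ x ∈ t • K}.indicator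
        (fun t => ENNReal.ofReal ((j + 1) * (1 - t) ^ j)) t =
      (Icc (0 : ℝ) 1).indicator
        (fun t => ENNReal.ofReal ((j + 1) * (t ^ k * (1 - t) ^ j)) * volume K) t := by
    by_cases ht : t ∈ Icc (0 : ℝ) 1
    · have ht1 : 0 ≤ 1 - t := sub_nonneg.2 ht.2
      have ht0 : 0 ≤ t := ht.1
      have (x : Fin k → ℝ) : {t : ℝ | t ∈ Icc 0 1 ∧ x ∈ t • K}.indicator
          (fun t => ENNReal.ofReal ((j + 1) * (1 - t) ^ j)) t =
          (t • K).indicator (fun _ => ENNReal.ofReal ((j + 1) * (1 - t) ^ j)) x := by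
        by_cases hx : x ∈ t • K
        · rw [indicator_of_mem hx]
          exact indicator_of_mem (s := {t : ℝ | t ∈ Icc 0 1 ∧ x ∈ t • K}) ⟨ht, hx⟩ _
        · rw [indicator_of_notMem hx, indicator_of_notMem fun h => hx h.2]
      simp only [this]
      rw [lintegral_indicator_const (hKc.smul t).measurableSet,
        Measure.addHaar_smul_of_nonneg volume ht.1, indicator_of_mem ht, ← mul_assoc,
        ← ENNReal.ofReal_mul (by positivity), Module.finrank_fin_fun]
      congr 2
      ring
    · simp [indicator, ht]
  simp only [hinner]
  rw [lintegral_indicator measurableSet_Icc, lintegral_mul_const _ (by fun_prop),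
    ← ofReal_integral_eq_lintegral_ofReal]
  · rw [integral_Icc_eq_integral_Ioc, ← intervalIntegral.integral_of_le zero_le_one,
      intervalIntegral.integral_const_mul, integral_pow_mul_one_sub_pow, ← mul_div_assoc,
      ENNReal.ofReal_div_of_pos (by positivity)]
    congr 2
    · rw [Nat.factorial_succ j, ← ENNReal.ofReal_natCast, ← ENNReal.ofReal_natCast,
        ← ENNReal.ofReal_mul (by positivity)]
      congr 1
      push_cast
      ring
    · rw [ENNReal.ofReal_natCast, add_assoc]
  · exact Continuous.integrableOn_Icc (by fun_prop)
  · filter_upwards [ae_restrict_mem measurableSet_Icc] with t ht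
    have : 0 ≤ 1 - t := sub_nonneg.2 ht.2
    have : 0 ≤ t := ht.1
    simp only [Pi.zero_apply]
    positivity

/-- Volume identity `|CH(σ, ⋆σ)| = (k! m! / n!) |σ| |⋆σ|` for the convex hull of a
compact convex `k`-dimensional set `K` and an `m`-dimensional set `L` lying in
orthogonal complementary subspaces of `ℝⁿ = ℝᵏ × ℝᵐ` through the origin. -/
theorem volume_convexHull_orthogonal_cells
    (k m : ℕ) (hk : 1 ≤ k) (hm : 1 ≤ m)
    (K : Set (Fin k → ℝ)) (L : Set (Fin m → ℝ))
    (hKc : IsCompact K) (hKconv : Convex ℝ K) (hK0 : (0 : Fin k → ℝ) ∈ K)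
    (hLc : IsCompact L) (hLconv : Convex ℝ L) (hL0 : (0 : Fin m → ℝ) ∈ L) :
    volume (convexHull ℝ
        (((fun x : Fin k → ℝ => (x, (0 : Fin m → ℝ))) '' K) ∪
          ((fun y : Fin m → ℝ => ((0 : Fin k → ℝ), y)) '' L))) =
      ((Nat.factorial k * Nat.factorial m : ℝ≥0∞) / (Nat.factorial (k + m) : ℝ≥0∞))
        * volume K * volume L := by
  obtain ⟨j, rfl⟩ : ∃ j, m = j + 1 := ⟨m - 1, by omega⟩
  rw [Measure.volume_eq_prod, Measure.prod_apply (isCompact_convexHull_union_prod_zero hKc hLc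
    hKconv hLconv ⟨0, hK0⟩ ⟨0, hL0⟩).measurableSet]
  simp only [volume_slice_convexHull_union_prod_zero hKc hKconv hK0 hLconv hL0]
  rw [lintegral_mul_const' _ _ hLc.measure_lt_top.ne, lintegral_lintegral_indicator_smul j hKc]
end
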